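/- Let m,n be positive integers with either m = n ≥ 3, or m ≠ n and m,n ≥ 2, and let 𝓛 : ℝ^{m×n} → ℝ^{m×n} be a linear transformation. Then the following are equivalent: (1) 𝓛 maps the set of SSR matrices onto itself; (2) 𝓛 maps the set of SSR₂ matrices onto itself; (3) 𝓛 is a composition of one or more of the following transformations: (a) A ↦ F·A·E, where F ∈ ℝ^{m×m} and E ∈ ℝ^{n×n} are diagonal matrices with positive diagonal entries; (b) A ↦ −A; (c) A ↦ P_m·A, where P_m is the m×m exchange matrix; (d) A ↦ A·P_n, where P_n is the n×n exchange matrix; (e) A ↦ Aᵀ, the last being allowed only when m = n. -/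

import Mathlib

open Matrix

/-- The `n × n` exchange matrix: ones on the antidiagonal, zeros elsewhere. -/
def exchangeMat (n : ℕ) : Matrix (Fin n) (Fin n) ℝ :=
  Matrix.of fun i j => if j = i.rev then (1 : ℝ) else 0

/-- `A` is strictly sign regular of order `k` (SSRₖ): for each `1 ≤ r ≤ k`
there is a sign `ε ∈ {1, -1}` such that every `r × r` minor of `A` has
sign `ε`. -/
def IsSSRk {m n : ℕ} (k : ℕ) (A : Matrix (Fin m) (Fin n) ℝ) : Prop :=
  ∀ r : ℕ, 1 ≤ r → r ≤ k →
    ∃ ε : ℝ, (ε = 1 ∨ ε = -1) ∧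
      ∀ (f : Fin r → Fin m) (g : Fin r → Fin n),
        StrictMono f → StrictMono g →
        0 < ε * (A.submatrix f g).det

/-- `A` is strictly sign regular (SSR): strictly sign regular of order `min m n`. -/
def IsSSR {m n : ℕ} (A : Matrix (Fin m) (Fin n) ℝ) : Prop :=
  IsSSRk (min m n) A

/-- The elementary transformations (a)–(e):
positive diagonal equivalence, negation, left/right multiplication by an
exchange matrix, and (when `m = n`) transposition. -/
def ElemSSRMap (m n : ℕ)
    (T : Matrix (Fin m) (Fin n) ℝ → Matrix (Fin m) (Fin n) ℝ) : Prop :=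
  (∃ F : Fin m → ℝ, ∃ Ed : Fin n → ℝ, (∀ i, 0 < F i) ∧ (∀ j, 0 < Ed j) ∧
      T = fun A => Matrix.diagonal F * A * Matrix.diagonal Ed) ∨
  (T = fun A => -A) ∨
  (T = fun A => exchangeMat m * A) ∨
  (T = fun A => A * exchangeMat n) ∨
  (∃ h : m = n,
      T = fun A => Matrix.of fun i j => A (Fin.cast h.symm j) (Fin.cast h i))

/-! ### Cauchy matrices -/

theorem det_cauchy_pos : ∀ {r : ℕ} (x y : Fin r → ℝ), StrictMono x → StrictMono y →
    (∀ i, 0 < x i) → (∀ j, 0 < y j) →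
    0 < (Matrix.of fun i j => 1 / (x i + y j)).det
  | 0, _, _, _, _, _, _ => by simp
  | r + 1, x, y, hx, hy, hx0, hy0 => by
    have hxy : ∀ i j, x i + y j ≠ 0 := fun i j => (add_pos (hx0 i) (hy0 j)).ne'
    let B : Matrix (Fin (r + 1)) (Fin (r + 1)) ℝ := Matrix.of fun i j =>
      if i = 0 then 1 / (x 0 + y j)
      else 1 / (x i + y j) - (x 0 + y 0) / (x i + y 0) * (1 / (x 0 + y j))
    have hdet : (Matrix.of fun i j => 1 / (x i + y j)).det = B.det := by
      refine det_eq_of_forall_row_eq_smul_add_const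
        (fun i => if i = 0 then 0 else (x 0 + y 0) / (x i + y 0)) 0 (by simp) fun i j => ?_
      by_cases hi : i = 0 <;> simp [B, hi]
    have hminor : B.submatrix (Fin.succAbove 0) Fin.succ =
        Matrix.of fun (i : Fin r) (j : Fin r) =>
          ((x i.succ - x 0) / (x i.succ + y 0)) *
          (Matrix.of fun (i : Fin r) (j : Fin r) => ((y j.succ - y 0) / (x 0 + y j.succ)) *
            (Matrix.of fun (i : Fin r) (j : Fin r) => 1 / (x i.succ + y j.succ)) i j) i j := by
      ext i j
      have h1 := hxy i.succ j.succ
      have h2 := hxy i.succ 0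
      have h3 := hxy 0 j.succ
      simp only [B, submatrix_apply, of_apply, Fin.succAbove_zero, Fin.succ_ne_zero, if_false]
      field_simp
      ring
    have hB : B.det = B 0 0 * (B.submatrix (Fin.succAbove 0) Fin.succ).det := by
      rw [det_succ_column_zero, Fin.sum_univ_succ, Finset.sum_eq_zero]
      · simp
      · intro i _
        have h2 := hxy i.succ 0
        have h3 := hxy 0 0
        have : B i.succ 0 = 0 := by
          simp only [B, of_apply, Fin.succ_ne_zero, if_false]
          field_simp
          ring
        simp [this]
    rw [hdet, hB, hminor, det_mul_column, det_mul_row]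
    have ih := det_cauchy_pos (fun i : Fin r => x i.succ) (fun j => y j.succ)
      (hx.comp Fin.strictMono_succ) (hy.comp Fin.strictMono_succ) (fun i => hx0 _) (fun j => hy0 _)
    have h00 : 0 < B 0 0 := by
      simpa [B] using add_pos (hx0 0) (hy0 0)
    refine mul_pos h00 (mul_pos (Finset.prod_pos fun i _ => ?_)
      (mul_pos (Finset.prod_pos fun j _ => ?_) ih))
    · exact div_pos (sub_pos.2 (hx (Fin.succ_pos i))) (add_pos (hx0 _) (hy0 _))
    · exact div_pos (sub_pos.2 (hy (Fin.succ_pos j))) (add_pos (hx0 _) (hy0 _))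

theorem isSSRk_cauchy_of_strictMono {m n : ℕ} (k : ℕ) {x : Fin m → ℝ} {y : Fin n → ℝ}
    (hx : StrictMono x) (hy : StrictMono y) (hx0 : ∀ i, 0 < x i) (hy0 : ∀ j, 0 < y j) :
    IsSSRk k (Matrix.of fun i j => 1 / (x i + y j)) := by
  refine fun r _ _ => ⟨1, Or.inl rfl, fun f g hf hg => ?_⟩
  rw [one_mul]
  exact det_cauchy_pos (x ∘ f) (y ∘ g) (hx.comp hf) (hy.comp hg) (fun _ => hx0 _) (fun _ => hy0 _)

/-! ### Symmetries of the set of strictly sign regular matrices -/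

theorem exchangeMat_mul {m n : ℕ} (A : Matrix (Fin m) (Fin n) ℝ) :
    exchangeMat m * A = A.submatrix Fin.rev id := by
  ext i j
  simp [exchangeMat, mul_apply]

theorem mul_exchangeMat {m n : ℕ} (A : Matrix (Fin m) (Fin n) ℝ) :
    A * exchangeMat n = A.submatrix id Fin.rev := by
  ext i j
  simp [exchangeMat, mul_apply, ← Fin.rev_eq_iff]

theorem IsSSRk.transpose {m n k : ℕ} {A : Matrix (Fin m) (Fin n) ℝ} (h : IsSSRk k A) :
    IsSSRk k Aᵀ := by
  intro r h1 hk
  obtain ⟨ε, hε, H⟩ := h r h1 hk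
  refine ⟨ε, hε, fun f g hf hg => ?_⟩
  rw [← transpose_submatrix, det_transpose]
  exact H g f hg hf

theorem IsSSRk.neg {m n k : ℕ} {A : Matrix (Fin m) (Fin n) ℝ} (h : IsSSRk k A) :
    IsSSRk k (-A) := by
  intro r h1 hk
  obtain ⟨ε, hε, H⟩ := h r h1 hk
  refine ⟨(-1) ^ r * ε, ?_, fun f g hf hg => ?_⟩
  · rcases neg_one_pow_eq_or ℝ r with hr | hr <;> rcases hε with rfl | rfl <;> simp [hr]
  · have hsq : ((-1 : ℝ) ^ r) * (-1) ^ r = 1 := by rw [← mul_pow]; simp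
    rw [submatrix_neg, Pi.neg_apply, Pi.neg_apply, det_neg, Fintype.card_fin]
    calc 0 < ε * (A.submatrix f g).det := H f g hf hg
      _ = (-1) ^ r * ε * ((-1) ^ r * (A.submatrix f g).det) := by
        linear_combination (-ε * (A.submatrix f g).det) * hsq

theorem IsSSRk.submatrix_rev_left {m n k : ℕ} {A : Matrix (Fin m) (Fin n) ℝ} (h : IsSSRk k A) :
    IsSSRk k (A.submatrix Fin.rev id) := by
  intro r h1 hk
  obtain ⟨ε, hε, H⟩ := h r h1 hk
  let s : ℝ := ((Equiv.Perm.sign (Fin.revPerm : Equiv.Perm (Fin r)) : ℤ) : ℝ)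
  have hs : s = 1 ∨ s = -1 := by
    rcases Int.units_eq_one_or (Equiv.Perm.sign (Fin.revPerm : Equiv.Perm (Fin r))) with h | h <;>
      simp [s, h]
  refine ⟨s * ε, ?_, fun f g hf hg => ?_⟩
  · rcases hs with hs | hs <;> rcases hε with rfl | rfl <;> simp [hs]
  · have hf' : StrictMono (Fin.rev ∘ f ∘ Fin.rev) := fun a b hab =>
      Fin.rev_lt_rev.2 (hf (Fin.rev_lt_rev.2 hab))
    have hsub : (A.submatrix Fin.rev id).submatrix f g =
        (A.submatrix (Fin.rev ∘ f ∘ Fin.rev) g).submatrix Fin.revPerm id := by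
      ext i j; simp
    have hdet := det_permute (Fin.revPerm : Equiv.Perm (Fin r))
      (A.submatrix (Fin.rev ∘ f ∘ Fin.rev) g)
    have hsq : s * s = 1 := by rcases hs with hs | hs <;> simp [hs]
    rw [hsub, hdet]
    calc 0 < ε * (A.submatrix (Fin.rev ∘ f ∘ Fin.rev) g).det := H _ g hf' hg
      _ = s * ε * (s * (A.submatrix (Fin.rev ∘ f ∘ Fin.rev) g).det) := by
        linear_combination (-ε * (A.submatrix (Fin.rev ∘ f ∘ Fin.rev) g).det) * hsq

theorem IsSSRk.submatrix_rev_right {m n k : ℕ} {A : Matrix (Fin m) (Fin n) ℝ} (h : IsSSRk k A) :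
    IsSSRk k (A.submatrix id Fin.rev) :=
  h.transpose.submatrix_rev_left.transpose

theorem IsSSRk.diagonal_mul_mul_diagonal {m n k : ℕ} {A : Matrix (Fin m) (Fin n) ℝ}
    (h : IsSSRk k A) {F : Fin m → ℝ} {E : Fin n → ℝ} (hF : ∀ i, 0 < F i) (hE : ∀ j, 0 < E j) :
    IsSSRk k (diagonal F * A * diagonal E) := by
  intro r h1 hk
  obtain ⟨ε, hε, H⟩ := h r h1 hk
  refine ⟨ε, hε, fun f g hf hg => ?_⟩
  have hsub : (diagonal F * A * diagonal E).submatrix f g =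
      diagonal (F ∘ f) * A.submatrix f g * diagonal (E ∘ g) := by
    ext i j
    simp [diagonal_mul, mul_diagonal]
  rw [hsub, det_mul, det_mul, det_diagonal, det_diagonal]
  calc 0 < (∏ i, F (f i)) * (ε * (A.submatrix f g).det) * ∏ j, E (g j) :=
        mul_pos (mul_pos (Finset.prod_pos fun _ _ => hF _) (H f g hf hg))
          (Finset.prod_pos fun _ _ => hE _)
    _ = _ := by simp only [Function.comp_apply]; ring

theorem ElemSSRMap.image_eq {m n : ℕ} (k : ℕ)
    {T : Matrix (Fin m) (Fin n) ℝ → Matrix (Fin m) (Fin n) ℝ} (hT : ElemSSRMap m n T) :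
    T '' {A | IsSSRk k A} = {A | IsSSRk k A} := by
  have key : ∀ T' : Matrix (Fin m) (Fin n) ℝ → Matrix (Fin m) (Fin n) ℝ,
      (∀ A, IsSSRk k A → IsSSRk k (T A)) → (∀ A, IsSSRk k A → IsSSRk k (T' A)) →
      (∀ A, T (T' A) = A) → T '' {A | IsSSRk k A} = {A | IsSSRk k A} := by
    intro T' h1 h2 h3
    ext B
    constructor
    · rintro ⟨A, hA, rfl⟩
      exact h1 A hA
    · intro hB
      exact ⟨T' B, h2 B hB, h3 B⟩
  rcases hT with ⟨F, E, hF, hE, rfl⟩ | rfl | rfl | rfl | ⟨h, rfl⟩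
  · refine key (fun A => diagonal (fun i => (F i)⁻¹) * A * diagonal fun j => (E j)⁻¹)
      (fun A hA => hA.diagonal_mul_mul_diagonal hF hE)
      (fun A hA => hA.diagonal_mul_mul_diagonal (fun i => inv_pos.2 (hF i))
        fun j => inv_pos.2 (hE j)) fun A => ?_
    ext i j
    have h1 := (hF i).ne'
    have h2 := (hE j).ne'
    simp only [diagonal_mul, mul_diagonal]
    field_simp
  · exact key (fun A => -A) (fun A hA => hA.neg) (fun A hA => hA.neg) fun A => neg_neg A
  · have h (A : Matrix (Fin m) (Fin n) ℝ) (hA : IsSSRk k A) : IsSSRk k (exchangeMat m * A) := by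
      rw [exchangeMat_mul]
      exact hA.submatrix_rev_left
    refine key _ h h fun A => ?_
    ext i j
    simp [exchangeMat_mul]
  · have h (A : Matrix (Fin m) (Fin n) ℝ) (hA : IsSSRk k A) : IsSSRk k (A * exchangeMat n) := by
      rw [mul_exchangeMat]
      exact hA.submatrix_rev_right
    refine key _ h h fun A => ?_
    ext i j
    simp [mul_exchangeMat]
  · subst h
    exact key Matrix.transpose (fun A hA => hA.transpose) (fun A hA => hA.transpose) fun A => rfl

/-- Nonempty compositions of the elementary transformations. -/
def IsSSRComposition (m n : ℕ)
    (T : Matrix (Fin m) (Fin n) ℝ → Matrix (Fin m) (Fin n) ℝ) : Prop :=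
  ∃ L : List (Matrix (Fin m) (Fin n) ℝ → Matrix (Fin m) (Fin n) ℝ),
    L ≠ [] ∧ (∀ T ∈ L, ElemSSRMap m n T) ∧ T = L.foldr (· ∘ ·) id

theorem ElemSSRMap.isSSRComposition {m n : ℕ}
    {T : Matrix (Fin m) (Fin n) ℝ → Matrix (Fin m) (Fin n) ℝ} (hT : ElemSSRMap m n T) :
    IsSSRComposition m n T :=
  ⟨[T], by simp, by simpa using hT, rfl⟩

theorem IsSSRComposition.comp {m n : ℕ}
    {T U : Matrix (Fin m) (Fin n) ℝ → Matrix (Fin m) (Fin n) ℝ}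
    (hT : IsSSRComposition m n T) (hU : IsSSRComposition m n U) :
    IsSSRComposition m n (T ∘ U) := by
  obtain ⟨L, hL, hLT, rfl⟩ := hT
  obtain ⟨L', hL', hLT', rfl⟩ := hU
  refine ⟨L ++ L', by simp [hL], fun T hT => (List.mem_append.1 hT).elim (hLT T) (hLT' T), ?_⟩
  clear hL hLT
  induction L with
  | nil => rfl
  | cons T L ih => simp [← ih, Function.comp_assoc]

theorem IsSSRComposition.image_eq {m n : ℕ} (k : ℕ)
    {T : Matrix (Fin m) (Fin n) ℝ → Matrix (Fin m) (Fin n) ℝ} (hT : IsSSRComposition m n T) :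
    T '' {A | IsSSRk k A} = {A | IsSSRk k A} := by
  obtain ⟨L, -, hL, rfl⟩ := hT
  induction L with
  | nil => simp
  | cons T L ih =>
    rw [List.foldr_cons, Set.image_comp, ih fun T hT => hL T (List.mem_cons_of_mem _ hT)]
    exact (hL T List.mem_cons_self).image_eq k

theorem isSSRk_cauchy {m n : ℕ} (k : ℕ) {x : Fin m → ℝ} {y : Fin n → ℝ}
    (hx : StrictMono x ∨ StrictAnti x) (hy : StrictMono y ∨ StrictAnti y)
    (hx0 : ∀ i, 0 < x i) (hy0 : ∀ j, 0 < y j) :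
    IsSSRk k (Matrix.of fun i j => 1 / (x i + y j)) := by
  have hleft : ∀ y : Fin n → ℝ, StrictMono y → (∀ j, 0 < y j) →
      IsSSRk k (Matrix.of fun i j => 1 / (x i + y j)) := by
    intro y hy hy0
    rcases hx with hx | hx
    · exact isSSRk_cauchy_of_strictMono k hx hy hx0 hy0
    · have := (isSSRk_cauchy_of_strictMono k (hx.comp Fin.rev_strictAnti) hy
        (fun i => hx0 _) hy0).submatrix_rev_left
      convert this using 1
      ext i j
      simp
  rcases hy with hy | hy
  · exact hleft y hy hy0
  · have := (hleft _ (hy.comp Fin.rev_strictAnti) (fun i => hy0 _)).submatrix_rev_right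
    convert this using 1
    ext i j
    simp

/-! ### Entries and two-by-two minors -/

theorem IsSSRk.exists_sign_entries {m n k : ℕ} (hk : 1 ≤ k) {A : Matrix (Fin m) (Fin n) ℝ}
    (h : IsSSRk k A) : ∃ ε : ℝ, (ε = 1 ∨ ε = -1) ∧ ∀ p q, 0 < ε * A p q := by
  obtain ⟨ε, hε, H⟩ := h 1 le_rfl hk
  refine ⟨ε, hε, fun p q => ?_⟩
  simpa using H (fun _ => p) (fun _ => q) (Subsingleton.strictMono _) (Subsingleton.strictMono _)

theorem IsSSRk.exists_sign_minors {m n k : ℕ} (hk : 2 ≤ k) {A : Matrix (Fin m) (Fin n) ℝ}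
    (h : IsSSRk k A) : ∃ ε : ℝ, (ε = 1 ∨ ε = -1) ∧ ∀ p p' q q', p < p' → q < q' →
      0 < ε * (A p q * A p' q' - A p q' * A p' q) := by
  obtain ⟨ε, hε, H⟩ := h 2 one_le_two hk
  refine ⟨ε, hε, fun p p' q q' hp hq => ?_⟩
  have := H ![p, p'] ![q, q'] (by simpa [Fin.strictMono_iff_lt_succ] using hp)
    (by simpa [Fin.strictMono_iff_lt_succ] using hq)
  rw [det_fin_two] at this
  simpa only [submatrix_apply, cons_val_zero, cons_val_one] using this

theorem IsSSRk.mul_ne_mul {m n k : ℕ} (hk : 2 ≤ k) {A : Matrix (Fin m) (Fin n) ℝ}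
    (h : IsSSRk k A) {p p' : Fin m} {q q' : Fin n} (hp : p ≠ p') (hq : q ≠ q') :
    A p q * A p' q' ≠ A p q' * A p' q := by
  obtain ⟨ε, -, H⟩ := h.exists_sign_minors hk
  intro heq
  rcases hp.lt_or_gt with hp | hp <;> rcases hq.lt_or_gt with hq | hq <;>
    have := H _ _ _ _ hp hq <;> simp_all [mul_comm]

theorem exists_strictMono_or_strictAnti {m : ℕ} {i i' : Fin m} (hi : i ≠ i') {T : ℝ}
    (hT : 1 < T) : ∃ x : Fin m → ℝ, (StrictMono x ∨ StrictAnti x) ∧ (∀ a, 0 < x a) ∧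
      x i = 1 ∧ x i' = T := by
  have hT0 : 0 < T := one_pos.trans hT
  have hne : ((i' : ℕ) : ℝ) - (i : ℕ) ≠ 0 := by
    rw [sub_ne_zero]
    exact fun h => hi (Fin.ext (Nat.cast_injective h.symm))
  refine ⟨fun a => T ^ ((((a : ℕ) : ℝ) - (i : ℕ)) / ((i' : ℕ) - (i : ℕ))), ?_,
    fun a => Real.rpow_pos_of_pos hT0 _, by simp, by simp [div_self hne]⟩
  rcases hne.lt_or_gt with h | h
  · refine Or.inr fun a b hab => Real.rpow_lt_rpow_of_exponent_lt hT
      (div_lt_div_of_neg_of_lt h (sub_lt_sub_right ?_ _))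
    exact_mod_cast hab
  · refine Or.inl fun a b hab => Real.rpow_lt_rpow_of_exponent_lt hT
      (div_lt_div_of_pos_right (sub_lt_sub_right ?_ _) h)
    exact_mod_cast hab

/-- Strictly sign regular matrices realise every cross ratio other than `1`. -/
theorem exists_isSSRk_crossRatio {m n : ℕ} (k : ℕ) {i i' : Fin m} {j j' : Fin n}
    (hi : i ≠ i') (hj : j ≠ j') {ρ : ℝ} (hρ : 0 < ρ) (hρ1 : ρ ≠ 1) :
    ∃ A : Matrix (Fin m) (Fin n) ℝ, IsSSRk k A ∧
      A i j * A i' j' = ρ * (A i j' * A i' j) := by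
  have key : ∀ (j j' : Fin n), j ≠ j' → ∀ ρ : ℝ, 1 < ρ →
      ∃ A : Matrix (Fin m) (Fin n) ℝ, IsSSRk k A ∧
        A i j * A i' j' = ρ * (A i j' * A i' j) := by
    intro j j' hj ρ hρ
    have hs := Real.mul_self_sqrt (show 0 ≤ ρ * (ρ - 1) by nlinarith)
    have hs0 := Real.sqrt_nonneg (ρ * (ρ - 1))
    set s := √(ρ * (ρ - 1))
    obtain ⟨x, hx, hx0, hxi, hxi'⟩ :=
      exists_strictMono_or_strictAnti hi (T := 2 * ρ - 1 + 2 * s) (by linarith)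
    obtain ⟨y, hy, hy0, hyj, hyj'⟩ :=
      exists_strictMono_or_strictAnti hj (T := 2 * ρ - 1 + 2 * s) (by linarith)
    refine ⟨_, isSSRk_cauchy k hx hy hx0 hy0, ?_⟩
    simp only [of_apply, hxi, hxi', hyj, hyj']
    have h1 : 1 + (2 * ρ - 1 + 2 * s) ≠ 0 := by nlinarith
    have h2 : (2 * ρ - 1 + 2 * s) ≠ 0 := by nlinarith
    have h3 : (2 * ρ - 1 + 2 * s) + 1 ≠ 0 := by nlinarith
    field_simp
    ring_nf
    linear_combination 4 * hs
  rcases hρ1.lt_or_gt with h | h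
  · obtain ⟨A, hA, h⟩ := key j' j hj.symm ρ⁻¹ ((one_lt_inv₀ hρ).2 h)
    refine ⟨A, hA, ?_⟩
    rw [h]
    field_simp
  · exact key j j' hj ρ h

/-- A matrix all of whose entries and two-by-two minors are positive. -/
theorem exists_isSSRk_pos (m n k : ℕ) : ∃ V : Matrix (Fin m) (Fin n) ℝ, IsSSRk k V ∧
    (∀ i j, 0 < V i j) ∧
    ∀ i i' j j', i < i' → j < j' → 0 < V i j * V i' j' - V i j' * V i' j := by
  have hmono : ∀ l : ℕ, StrictMono fun i : Fin l => ((i : ℕ) : ℝ) + 1 := fun l a b hab => by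
    simpa using hab
  have hpos : ∀ (l : ℕ) (i : Fin l), (0 : ℝ) < ((i : ℕ) : ℝ) + 1 := fun l i => by positivity
  refine ⟨_, isSSRk_cauchy k (Or.inl (hmono m)) (Or.inl (hmono n)) (hpos m) (hpos n),
    fun i j => ?_, fun i i' j j' hi hj => ?_⟩
  · simp only [of_apply]
    positivity
  · have hlt_i : ((i : ℕ) : ℝ) < (i' : ℕ) := by exact_mod_cast hi
    have hlt_j : ((j : ℕ) : ℝ) < (j' : ℕ) := by exact_mod_cast hj
    simp only [of_apply]
    rw [sub_pos]
    simp only [one_div, ← mul_inv]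
    refine inv_strictAnti₀ (by positivity) ?_
    nlinarith [mul_pos (sub_pos.2 hlt_i) (sub_pos.2 hlt_j)]

/-! ### Linear maps preserving strict sign regularity are monomial -/

theorem forall_pos_or_forall_neg {ι κ : Type*} {φ : (ι → ℝ) × (κ → ℝ) → ℝ} (hφ : Continuous φ)
    (h : ∀ F E, (∀ i, 0 < F i) → (∀ j, 0 < E j) → φ (F, E) ≠ 0) :
    (∀ F E, (∀ i, 0 < F i) → (∀ j, 0 < E j) → 0 < φ (F, E)) ∨
      ∀ F E, (∀ i, 0 < F i) → (∀ j, 0 < E j) → φ (F, E) < 0 := by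
  let S : Set ((ι → ℝ) × (κ → ℝ)) := (Set.univ.pi fun _ => Set.Ioi 0) ×ˢ
    (Set.univ.pi fun _ => Set.Ioi 0)
  have hS : IsPreconnected S := Convex.isPreconnected <|
    (convex_pi fun _ _ => convex_Ioi 0).prod (convex_pi fun _ _ => convex_Ioi 0)
  have hmem : ∀ F E, (∀ i, 0 < F i) → (∀ j, 0 < E j) → ((F, E) : (ι → ℝ) × (κ → ℝ)) ∈ S :=
    fun F E hF hE => ⟨fun i _ => hF i, fun j _ => hE j⟩
  by_contra! hcon
  obtain ⟨⟨F, E, hF, hE, h1⟩, F', E', hF', hE', h2⟩ := hcon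
  obtain ⟨⟨F'', E''⟩, ⟨hF'', hE''⟩, h3⟩ := hS.intermediate_value (hmem F E hF hE)
    (hmem F' E' hF' hE') hφ.continuousOn ⟨h1, h2⟩
  exact h F'' E'' (fun i => hF'' i trivial) (fun j => hE'' j trivial) h3

theorem diagonal_single_mul_mul_diagonal_single {m n : ℕ} (V : Matrix (Fin m) (Fin n) ℝ)
    (i : Fin m) (j : Fin n) :
    diagonal (Pi.single i (1 : ℝ)) * V * diagonal (Pi.single j (1 : ℝ)) =
      V i j • single i j (1 : ℝ) := by
  ext p q
  by_cases hp : i = p <;> by_cases hq : j = q <;>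
    simp [diagonal_mul, mul_diagonal, hp, hq, eq_comm (a := p), eq_comm (a := q)]

theorem exists_sign_apply_single {m n k : ℕ} (hk : 1 ≤ k) (hm : 0 < m) (hn : 0 < n)
    (L : Matrix (Fin m) (Fin n) ℝ →ₗ[ℝ] Matrix (Fin m) (Fin n) ℝ)
    (hL : ∀ A, IsSSRk k A → IsSSRk k (L A)) :
    ∃ s : ℝ, (s = 1 ∨ s = -1) ∧ ∀ i j p q, 0 ≤ s * L (single i j 1) p q := by
  obtain ⟨V, hV, hV0, -⟩ := exists_isSSRk_pos m n k
  let G : (Fin m → ℝ) × (Fin n → ℝ) → Matrix (Fin m) (Fin n) ℝ :=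
    fun P => L (diagonal P.1 * V * diagonal P.2)
  have hG : Continuous G := by
    have := L.continuous_of_finiteDimensional
    fun_prop
  have hent : ∀ F E, (∀ i, 0 < F i) → (∀ j, 0 < E j) →
      ∃ ε : ℝ, (ε = 1 ∨ ε = -1) ∧ ∀ p q, 0 < ε * G (F, E) p q := fun F E hF hE =>
    (hL _ (hV.diagonal_mul_mul_diagonal hF hE)).exists_sign_entries hk
  have hGe : ∀ p q, Continuous fun P => G P p q := fun p q => by fun_prop
  have hsign : ∃ s : ℝ, (s = 1 ∨ s = -1) ∧ ∀ F E, (∀ i, 0 < F i) → (∀ j, 0 < E j) →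
      ∀ p q, 0 < s * G (F, E) p q := by
    rcases forall_pos_or_forall_neg (hGe ⟨0, hm⟩ ⟨0, hn⟩) (fun F E hF hE h0 => by
      obtain ⟨ε, -, h⟩ := hent F E hF hE
      simpa [h0] using h ⟨0, hm⟩ ⟨0, hn⟩) with h | h
    · refine ⟨1, Or.inl rfl, fun F E hF hE p q => ?_⟩
      obtain ⟨ε, rfl | rfl, hε⟩ := hent F E hF hE
      · exact hε p q
      · linarith [h F E hF hE, hε ⟨0, hm⟩ ⟨0, hn⟩]
    · refine ⟨-1, Or.inr rfl, fun F E hF hE p q => ?_⟩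
      obtain ⟨ε, rfl | rfl, hε⟩ := hent F E hF hE
      · linarith [h F E hF hE, hε ⟨0, hm⟩ ⟨0, hn⟩]
      · exact hε p q
  obtain ⟨s, hs, H⟩ := hsign
  refine ⟨s, hs, fun i j p q => ?_⟩
  let c : ℝ → (Fin m → ℝ) × (Fin n → ℝ) := fun t =>
    (Pi.single i 1 + fun _ => t, Pi.single j 1 + fun _ => t)
  have hc : Continuous fun t => s * G (c t) p q := by
    have : Continuous c := by fun_prop
    exact continuous_const.mul ((hGe p q).comp this)
  have hpos : ∀ t > 0, 0 ≤ s * G (c t) p q := by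
    intro t ht
    refine (H _ _ (fun a => ?_) (fun b => ?_) p q).le
    · exact add_pos_of_nonneg_of_pos (by rw [Pi.single_apply]; split_ifs <;> simp) ht
    · exact add_pos_of_nonneg_of_pos (by rw [Pi.single_apply]; split_ifs <;> simp) ht
  have h0 : 0 ≤ s * G (c 0) p q :=
    ge_of_tendsto (hc.continuousAt.tendsto.mono_left nhdsWithin_le_nhds)
      (eventually_mem_nhdsWithin (s := Set.Ioi (0 : ℝ)) |>.mono hpos)
  have hc0 : c 0 = (Pi.single i 1, Pi.single j 1) := by
    ext <;> simp [c]
  rw [hc0] at h0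
  simp only [G, diagonal_single_mul_mul_diagonal_single, map_smul, Matrix.smul_apply,
    smul_eq_mul] at h0
  refine nonneg_of_mul_nonneg_right (a := V i j) ?_ (hV0 i j)
  linarith

theorem surjective_of_image_eq {m n k : ℕ}
    (L : Matrix (Fin m) (Fin n) ℝ →ₗ[ℝ] Matrix (Fin m) (Fin n) ℝ)
    (hL : L '' {A | IsSSRk k A} = {A | IsSSRk k A}) : Function.Surjective L := by
  obtain ⟨V, hV, hV0, -⟩ := exists_isSSRk_pos m n k
  have hmem : ∀ A, IsSSRk k A → A ∈ LinearMap.range L := by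
    intro A hA
    obtain ⟨B, -, hB⟩ : A ∈ L '' {A | IsSSRk k A} := hL.symm ▸ hA
    exact ⟨B, hB⟩
  have hscale : ∀ (F : Fin m → ℝ) (E : Fin n → ℝ), (∀ i, 0 < F i) → (∀ j, 0 < E j) →
      diagonal F * V * diagonal E ∈ LinearMap.range L := fun F E hF hE =>
    hmem _ (hV.diagonal_mul_mul_diagonal hF hE)
  have hone : ∀ {l : ℕ} (i a : Fin l), 0 < (1 + Pi.single i 1 : Fin l → ℝ) a := by
    intro l i a
    exact add_pos_of_pos_of_nonneg one_pos (by rw [Pi.single_apply]; split_ifs <;> simp)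
  have hone' : ∀ {l : ℕ} (a : Fin l), 0 < (1 : Fin l → ℝ) a := fun _ => one_pos
  have hsingle : ∀ i j, single i j (1 : ℝ) ∈ LinearMap.range L := by
    intro i j
    have h := Submodule.add_mem _ (Submodule.sub_mem _ (Submodule.sub_mem _
      (hscale _ _ (hone i) (hone j)) (hscale _ _ (hone i) hone'))
      (hscale _ _ hone' (hone j))) (hscale _ _ hone' hone')
    have heq : ∀ (F : Fin m → ℝ) (E : Fin n → ℝ),
        diagonal (1 + F) * V * diagonal (1 + E) -
          diagonal (1 + F) * V * diagonal (1 : Fin n → ℝ) -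
          diagonal (1 : Fin m → ℝ) * V * diagonal (1 + E) +
          diagonal (1 : Fin m → ℝ) * V * diagonal (1 : Fin n → ℝ) =
        diagonal F * V * diagonal E := by
      intro F E
      ext p q
      simp only [Matrix.add_apply, Matrix.sub_apply, diagonal_mul, mul_diagonal, Pi.add_apply,
        Pi.one_apply]
      ring
    rw [heq, diagonal_single_mul_mul_diagonal_single] at h
    exact ((LinearMap.range L).smul_mem_iff (hV0 i j).ne').1 h
  intro A
  rw [← LinearMap.mem_range, matrix_eq_sum_single A]
  refine Submodule.sum_mem _ fun i _ => Submodule.sum_mem _ fun j _ => ?_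
  have := Submodule.smul_mem (LinearMap.range L) (A i j) (hsingle i j)
  simpa using this

/-- A nonnegative matrix with nonnegative inverse is monomial. -/
theorem exists_monomial_of_nonneg {ι : Type*} [Fintype ι] [DecidableEq ι] {P Q : Matrix ι ι ℝ}
    (hP : ∀ a b, 0 ≤ P a b) (hQ : ∀ a b, 0 ≤ Q a b) (hPQ : P * Q = 1) :
    ∃ τ : ι → ι, Function.Injective τ ∧ (∀ b, 0 < P b (τ b)) ∧ ∀ b a, a ≠ τ b → P b a = 0 := by
  have hQP : Q * P = 1 := mul_eq_one_comm.1 hPQ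
  have hex : ∀ b, ∃ a, 0 < P b a ∧ 0 < Q a b := by
    intro b
    have h1 : 0 < ∑ a, P b a * Q a b := by
      rw [← mul_apply, hPQ, one_apply_eq]
      exact one_pos
    obtain ⟨a, -, ha⟩ := Finset.exists_lt_of_sum_lt (s := Finset.univ) (f := fun _ : ι => (0 : ℝ))
      (g := fun a => P b a * Q a b) (by simpa using h1)
    exact ⟨a, pos_of_mul_pos_left ha (hQ _ _), pos_of_mul_pos_right ha (hP _ _)⟩
  have hzero : ∀ {R S : Matrix ι ι ℝ}, (∀ a b, 0 ≤ R a b) → (∀ a b, 0 ≤ S a b) → R * S = 1 →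
      ∀ {a c}, a ≠ c → ∀ b, R a b * S b c = 0 := by
    intro R S hR hS hRS a c hac b
    have h0 : ∑ b, R a b * S b c = 0 := by rw [← mul_apply, hRS, one_apply_ne hac]
    exact (Finset.sum_eq_zero_iff_of_nonneg fun b _ => mul_nonneg (hR _ _) (hS _ _)).1 h0 b
      (Finset.mem_univ b)
  choose τ hτP hτQ using hex
  refine ⟨τ, fun b b' hbb => ?_, hτP, fun b a ha => ?_⟩
  · by_contra hne
    have := hzero hP hQ hPQ hne (τ b)
    have h2 := hτQ b'
    rw [← hbb] at h2
    exact (mul_pos (hτP b) h2).ne' this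
  · exact (mul_eq_zero.1 (hzero hQ hP hQP ha.symm b)).resolve_left (ne_of_gt (hτQ b))

/-! ### The permutation of the cells -/

theorem exists_pow_mul_eq_pow_mul {N M : ℕ} (h : N ≠ M) {a b : ℝ} (ha : 0 < a) (hb : 0 < b) :
    ∃ t : ℝ, 0 < t ∧ t ^ N * a = t ^ M * b := by
  wlog hlt : N < M generalizing N M a b
  · obtain ⟨t, ht, h⟩ := this h.symm hb ha (by omega)
    exact ⟨t, ht, h.symm⟩
  obtain ⟨c, rfl⟩ := Nat.exists_eq_add_of_lt hlt
  refine ⟨(a / b) ^ (((c + 1 : ℕ) : ℝ)⁻¹), Real.rpow_pos_of_pos (div_pos ha hb) _, ?_⟩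
  rw [add_assoc, pow_add, Real.rpow_inv_natCast_pow (div_pos ha hb).le (Nat.succ_ne_zero c)]
  field_simp

theorem pair_eq_of_count_eq {X : Type*} [DecidableEq X] {a b c d : X}
    (h : ∀ i, (if a = i then 1 else 0) + (if d = i then 1 else 0) =
      (if b = i then 1 else 0) + if c = i then 1 else 0) :
    (a = b ∧ d = c) ∨ (a = c ∧ d = b) := by
  have h1 := h a
  have h2 := h d
  have h3 := h b
  grind

/-- A map between grids sends opposite corners of rectangles to opposite corners of rectangles. -/
def PreservesRectangles {M N X Y : Type*} (τ : M × N → X × Y) : Prop :=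
  ∀ p p' q q', p ≠ p' → q ≠ q' →
    ((τ (p, q)).1 = (τ (p, q')).1 ∧ (τ (p', q')).1 = (τ (p', q)).1 ∧
      (τ (p, q)).2 = (τ (p', q)).2 ∧ (τ (p', q')).2 = (τ (p, q')).2) ∨
    ((τ (p, q)).1 = (τ (p', q)).1 ∧ (τ (p', q')).1 = (τ (p, q')).1 ∧
      (τ (p, q)).2 = (τ (p, q')).2 ∧ (τ (p', q')).2 = (τ (p', q)).2)

theorem PreservesRectangles.swap {M N X Y : Type*} {τ : M × N → X × Y}
    (h : PreservesRectangles τ) : PreservesRectangles (Prod.swap ∘ τ) := by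
  intro p p' q q' hp hq
  have := h p p' q q' hp hq
  simp only [Function.comp_apply, Prod.fst_swap, Prod.snd_swap]
  tauto

theorem PreservesRectangles.exists_prod {M N X Y : Type*} {τ : M × N → X × Y}
    (h : PreservesRectangles τ) (hτ : Function.Injective τ) {p₀ p₁ : M} (hp : p₀ ≠ p₁) {q₀ q₁ : N}
    (hq : q₀ ≠ q₁) (hrow : (τ (p₀, q₀)).1 = (τ (p₀, q₁)).1) :
    ∃ (α : M → X) (β : N → Y), Function.Injective α ∧ Function.Injective β ∧
      ∀ p q, τ (p, q) = (α p, β q) := by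
  have hinj : ∀ {p p' q q'}, (τ (p, q)).1 = (τ (p', q')).1 → (τ (p, q)).2 = (τ (p', q')).2 →
      p = p' ∧ q = q' := fun h1 h2 => Prod.mk.inj (hτ (Prod.ext h1 h2))
  have h1 : ∀ q, (τ (p₀, q₀)).1 = (τ (p₀, q)).1 := by
    intro q
    by_cases hq0 : q₀ = q
    · rw [hq0]
    by_cases hq1 : q₁ = q
    · rw [← hq1, hrow]
    rcases h p₀ p₁ q₀ q hp hq0 with h0 | h0
    · exact h0.1
    · rcases h p₀ p₁ q₁ q hp hq1 with h2 | h2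
      · exact hrow.trans h2.1
      · exact absurd (hinj hrow (h0.2.2.1.trans h2.2.2.1.symm)).2 hq
  have h2 : ∀ p q q', p₀ ≠ p → q ≠ q' →
      (τ (p, q)).1 = (τ (p, q')).1 ∧ (τ (p, q)).2 = (τ (p₀, q)).2 := by
    intro p q q' hp hq
    rcases h p₀ p q q' hp hq with h0 | h0
    · exact ⟨h0.2.1.symm, h0.2.2.1.symm⟩
    · exact absurd (hinj ((h1 q).symm.trans (h1 q')) h0.2.2.1).2 hq
  have h3 : ∀ p q, τ (p, q) = ((τ (p, q₀)).1, (τ (p₀, q)).2) := by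
    intro p q
    by_cases hp0 : p₀ = p
    · subst hp0
      exact Prod.ext (h1 q).symm rfl
    by_cases hq0 : q = q₀
    · subst hq0
      exact Prod.ext rfl (h2 p q q₁ hp0 hq).2
    · exact Prod.ext (h2 p q q₀ hp0 hq0).1 (h2 p q q₀ hp0 hq0).2
  refine ⟨fun p => (τ (p, q₀)).1, fun q => (τ (p₀, q)).2, fun p p' hpp => ?_, fun q q' hqq => ?_,
    h3⟩
  · have h4 := h3 p q₀
    have h5 := h3 p' q₀
    exact (hinj hpp (by rw [h4, h5])).1
  · exact (hinj ((h1 q).symm.trans (h1 q')) hqq).2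

theorem preservesRectangles_of_monomial {m n k : ℕ} (hk : 2 ≤ k)
    {L : Matrix (Fin m) (Fin n) ℝ → Matrix (Fin m) (Fin n) ℝ}
    (hL : ∀ A, IsSSRk k A → IsSSRk k (L A)) {s : ℝ}
    {d : Fin m → Fin n → ℝ} (hd : ∀ p q, 0 < d p q) {τ : Fin m × Fin n → Fin m × Fin n}
    (hτ : Function.Injective τ)
    (hLA : ∀ A p q, L A p q = s * d p q * A (τ (p, q)).1 (τ (p, q)).2) :
    PreservesRectangles τ := by
  intro p p' q q' hp hq
  obtain ⟨V, hV, hV0, -⟩ := exists_isSSRk_pos m n k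
  set a := τ (p, q) with ha
  set b := τ (p, q') with hb
  set c := τ (p', q) with hc
  set e := τ (p', q') with he
  have hne : ∀ (F : Fin m → ℝ) (E : Fin n → ℝ), (∀ i, 0 < F i) → (∀ j, 0 < E j) →
      (F a.1 * E a.2) * (F e.1 * E e.2) * (d p q * d p' q' * (V a.1 a.2 * V e.1 e.2)) ≠
      (F b.1 * E b.2) * (F c.1 * E c.2) * (d p q' * d p' q * (V b.1 b.2 * V c.1 c.2)) := by
    intro F E hF hE heq
    refine (hL _ (hV.diagonal_mul_mul_diagonal hF hE)).mul_ne_mul hk hp hq ?_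
    simp only [hLA, diagonal_mul, mul_diagonal, ← ha, ← hb, ← hc, ← he]
    linear_combination s ^ 2 * heq
  have hK1 : 0 < d p q * d p' q' * (V a.1 a.2 * V e.1 e.2) :=
    mul_pos (mul_pos (hd _ _) (hd _ _)) (mul_pos (hV0 _ _) (hV0 _ _))
  have hK2 : 0 < d p q' * d p' q * (V b.1 b.2 * V c.1 c.2) :=
    mul_pos (mul_pos (hd _ _) (hd _ _)) (mul_pos (hV0 _ _) (hV0 _ _))
  have hrow : (a.1 = b.1 ∧ e.1 = c.1) ∨ (a.1 = c.1 ∧ e.1 = b.1) := by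
    refine pair_eq_of_count_eq fun i => ?_
    by_contra hcount
    obtain ⟨t, ht, hteq⟩ := exists_pow_mul_eq_pow_mul hcount hK1 hK2
    refine hne (fun r => t ^ (if r = i then 1 else 0)) (fun _ => 1) (fun _ => pow_pos ht _)
      (fun _ => one_pos) ?_
    simpa only [mul_one, ← pow_add] using hteq
  have hcol : (a.2 = b.2 ∧ e.2 = c.2) ∨ (a.2 = c.2 ∧ e.2 = b.2) := by
    refine pair_eq_of_count_eq fun i => ?_
    by_contra hcount
    obtain ⟨t, ht, hteq⟩ := exists_pow_mul_eq_pow_mul hcount hK1 hK2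
    refine hne (fun _ => 1) (fun r => t ^ (if r = i then 1 else 0)) (fun _ => one_pos)
      (fun _ => pow_pos ht _) ?_
    simpa only [one_mul, ← pow_add] using hteq
  have hab : ¬(a.1 = b.1 ∧ a.2 = b.2) := fun h =>
    hq (Prod.mk.inj (hτ (Prod.ext h.1 h.2 : a = b))).2
  have hac : ¬(a.1 = c.1 ∧ a.2 = c.2) := fun h =>
    hp (Prod.mk.inj (hτ (Prod.ext h.1 h.2 : a = c))).1
  tauto

/-! ### Row and column permutations -/

theorem eq_id_of_strictMono {m : ℕ} {α : Fin m → Fin m} (h : StrictMono α) : α = id :=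
  (h.range_inj strictMono_id).1 <| by
    rw [(Finite.injective_iff_surjective.1 h.injective).range_eq, Set.range_id]

theorem eq_rev_of_strictAnti {m : ℕ} {α : Fin m → Fin m} (h : StrictAnti α) : α = Fin.rev := by
  have := eq_id_of_strictMono (h.comp Fin.rev_strictAnti)
  funext i
  simpa using congrFun this i.rev

theorem eq_id_or_eq_rev_of_minors {m n : ℕ} {V : Matrix (Fin m) (Fin n) ℝ}
    (hV : ∀ i i' j j', i < i' → j < j' → 0 < V i j * V i' j' - V i j' * V i' j)
    {α : Fin m → Fin m} (hα : Function.Injective α) {j j' : Fin n} (hj : j ≠ j') {ε : ℝ}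
    (h : ∀ p p', p < p' →
      0 < ε * (V (α p) j * V (α p') j' - V (α p) j' * V (α p') j)) :
    α = id ∨ α = Fin.rev := by
  wlog hlt : j < j' generalizing j j' ε
  · refine this hj.symm (ε := -ε) (fun p p' hp => ?_) (hj.symm.lt_of_le (not_lt.1 hlt))
    linarith [h p p' hp]
  rcases le_or_gt ε 0 with hε | hε
  · refine Or.inr (eq_rev_of_strictAnti fun p p' hp => ?_)
    by_contra hcon
    have h1 := hV _ _ _ _ ((not_lt.1 hcon).lt_of_ne fun h => hp.ne (hα h)) hlt
    have h2 := h p p' hp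
    nlinarith
  · refine Or.inl (eq_id_of_strictMono fun p p' hp => ?_)
    by_contra hcon
    have h1 := hV _ _ _ _ ((not_lt.1 hcon).lt_of_ne fun h => hp.ne (hα h).symm) hlt
    have h2 := h p p' hp
    nlinarith

theorem isSSRComposition_diagonal {m n : ℕ} {F : Fin m → ℝ} {E : Fin n → ℝ}
    (hF : ∀ i, 0 < F i) (hE : ∀ j, 0 < E j) :
    IsSSRComposition m n fun A => diagonal F * A * diagonal E :=
  ElemSSRMap.isSSRComposition (Or.inl ⟨F, E, hF, hE, rfl⟩)

theorem isSSRComposition_id (m n : ℕ) : IsSSRComposition m n id := by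
  convert isSSRComposition_diagonal (m := m) (n := n) (F := 1) (E := 1) (fun _ => one_pos)
    fun _ => one_pos using 1
  ext A i j
  simp

theorem isSSRComposition_of_product {m n k : ℕ} (hk : 2 ≤ k) (hm : 2 ≤ m) (hn : 2 ≤ n)
    {L : Matrix (Fin m) (Fin n) ℝ → Matrix (Fin m) (Fin n) ℝ}
    (hL : ∀ A, IsSSRk k A → IsSSRk k (L A)) {s : ℝ} (hs : s = 1 ∨ s = -1)
    {d : Fin m → Fin n → ℝ} (hd : ∀ p q, 0 < d p q) {α : Fin m → Fin m} {β : Fin n → Fin n}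
    (hα : Function.Injective α) (hβ : Function.Injective β)
    (hLA : ∀ A p q, L A p q = s * d p q * A (α p) (β q)) :
    IsSSRComposition m n L := by
  have hrank : ∀ p p' q q', d p q * d p' q' = d p q' * d p' q := by
    intro p p' q q'
    by_cases hp : p = p'
    · rw [hp, mul_comm]
    by_cases hq : q = q'
    · rw [hq]
    by_contra hne
    have hD : 0 < d p q * d p' q' := mul_pos (hd _ _) (hd _ _)
    obtain ⟨A, hA, hcross⟩ := exists_isSSRk_crossRatio k (hα.ne hp) (hβ.ne hq)
      (div_pos (mul_pos (hd p q') (hd p' q)) hD)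
      (fun h => hne ((div_eq_one_iff_eq hD.ne').1 h).symm)
    refine (hL A hA).mul_ne_mul hk hp hq ?_
    rw [div_mul_eq_mul_div, eq_div_iff hD.ne'] at hcross
    simp only [hLA]
    linear_combination s ^ 2 * hcross
  let i₀ : Fin m := ⟨0, by omega⟩
  let i₁ : Fin m := ⟨1, by omega⟩
  let j₀ : Fin n := ⟨0, by omega⟩
  let j₁ : Fin n := ⟨1, by omega⟩
  have hi : i₀ < i₁ := Nat.zero_lt_one
  have hj : j₀ < j₁ := Nat.zero_lt_one
  obtain ⟨V, hV, -, hV2⟩ := exists_isSSRk_pos m n k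
  obtain ⟨ε, -, hε⟩ := (hL V hV).exists_sign_minors hk
  have hs2 : s * s = 1 := by rcases hs with rfl | rfl <;> norm_num
  have hminor : ∀ p p' q q', p < p' → q < q' → 0 < ε * (V (α p) (β q) * V (α p') (β q') -
      V (α p) (β q') * V (α p') (β q)) := by
    intro p p' q q' hp hq
    have h1 := hε p p' q q' hp hq
    have hpos : 0 < d p q * d p' q' := mul_pos (hd _ _) (hd _ _)
    refine pos_of_mul_pos_right (a := d p q * d p' q') ?_ hpos.le
    simp only [hLA] at h1
    refine h1.trans_eq ?_
    linear_combination
      (ε * d p q * d p' q' * V (α p) (β q) * V (α p') (β q') -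
        ε * d p q' * d p' q * V (α p) (β q') * V (α p') (β q)) * hs2 +
      ε * V (α p) (β q') * V (α p') (β q) * hrank p p' q q'
  have hα' : α = id ∨ α = Fin.rev :=
    eq_id_or_eq_rev_of_minors hV2 hα (hβ.ne hj.ne) fun p p' hp => hminor p p' j₀ j₁ hp hj
  have hβ' : β = id ∨ β = Fin.rev := by
    refine eq_id_or_eq_rev_of_minors (V := Vᵀ) (ε := ε) (fun i i' j j' hi hj => ?_) hβ
      (hα.ne hi.ne) fun q q' hq => ?_
    · have := hV2 j j' i i' hj hi
      simp only [transpose_apply]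
      linarith
    · have := hminor i₀ i₁ q q' hi hq
      simp only [transpose_apply]
      linarith
  have hsign : IsSSRComposition m n fun A => s • A := by
    rcases hs with rfl | rfl
    · simp only [one_smul]
      exact isSSRComposition_id m n
    · simpa using (ElemSSRMap.isSSRComposition (m := m) (n := n) (Or.inr (Or.inl rfl)))
  have hrow : IsSSRComposition m n fun A => A.submatrix α id := by
    rcases hα' with rfl | rfl
    · exact isSSRComposition_id m n
    · exact ElemSSRMap.isSSRComposition
        (Or.inr (Or.inr (Or.inl (funext fun A => (exchangeMat_mul A).symm))))
  have hcol : IsSSRComposition m n fun A => A.submatrix id β := by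
    rcases hβ' with rfl | rfl
    · exact isSSRComposition_id m n
    · exact ElemSSRMap.isSSRComposition
        (Or.inr (Or.inr (Or.inr (Or.inl (funext fun A => (mul_exchangeMat A).symm)))))
  have hdiag := isSSRComposition_diagonal (F := fun p => d p j₀) (E := fun q => d i₀ q / d i₀ j₀)
    (fun _ => hd _ _) fun _ => div_pos (hd _ _) (hd _ _)
  convert hdiag.comp (hsign.comp (hrow.comp hcol)) using 1
  ext A p q
  have h00 := (hd i₀ j₀).ne'
  have hr := hrank p i₀ q j₀
  have hdpq : d p q = d p j₀ * (d i₀ q / d i₀ j₀) := by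
    rw [← mul_div_assoc, eq_div_iff h00, hr]
  simp only [Function.comp_apply, diagonal_mul, mul_diagonal, Matrix.smul_apply, submatrix_apply,
    id_eq, smul_eq_mul, hLA, hdpq]
  ring

theorem linearMap_apply_eq_sum {m n : ℕ}
    (L : Matrix (Fin m) (Fin n) ℝ →ₗ[ℝ] Matrix (Fin m) (Fin n) ℝ) (A : Matrix (Fin m) (Fin n) ℝ)
    (p : Fin m) (q : Fin n) :
    L A p q = ∑ a : Fin m × Fin n, L (single a.1 a.2 1) p q * A a.1 a.2 := by
  have h : A = ∑ a : Fin m × Fin n, A a.1 a.2 • single a.1 a.2 (1 : ℝ) := by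
    conv_lhs => rw [matrix_eq_sum_single A]
    rw [Fintype.sum_prod_type]
    simp
  conv_lhs => rw [h]
  simp only [map_sum, map_smul, Matrix.sum_apply, Matrix.smul_apply, smul_eq_mul, mul_comm]

theorem exists_monomial_form {m n k : ℕ} (hk : 1 ≤ k) (hm : 0 < m) (hn : 0 < n)
    (L : Matrix (Fin m) (Fin n) ℝ →ₗ[ℝ] Matrix (Fin m) (Fin n) ℝ)
    (hL : L '' {A | IsSSRk k A} = {A | IsSSRk k A}) :
    ∃ (s : ℝ) (d : Fin m → Fin n → ℝ) (τ : Fin m × Fin n → Fin m × Fin n),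
      (s = 1 ∨ s = -1) ∧ (∀ p q, 0 < d p q) ∧ Function.Injective τ ∧
      ∀ A p q, L A p q = s * d p q * A (τ (p, q)).1 (τ (p, q)).2 := by
  have hsurj := surjective_of_image_eq L hL
  let e := LinearEquiv.ofBijective L ⟨LinearMap.injective_iff_surjective.2 hsurj, hsurj⟩
  have hmaps : ∀ A, IsSSRk k A → IsSSRk k (L A) := fun A hA =>
    hL.subset (Set.mem_image_of_mem L hA)
  have hmaps' : ∀ A, IsSSRk k A → IsSSRk k (e.symm A) := by
    intro A hA
    obtain ⟨B, hB, rfl⟩ : A ∈ L '' {A | IsSSRk k A} := hL.symm ▸ hA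
    have : e.symm (L B) = B := e.symm_apply_apply B
    rwa [this]
  obtain ⟨s, hs, hsL⟩ := exists_sign_apply_single hk hm hn L hmaps
  obtain ⟨s', hs', hsL'⟩ := exists_sign_apply_single hk hm hn e.symm.toLinearMap hmaps'
  let P : Matrix (Fin m × Fin n) (Fin m × Fin n) ℝ := Matrix.of fun b a =>
    s * L (single a.1 a.2 1) b.1 b.2
  let Q : Matrix (Fin m × Fin n) (Fin m × Fin n) ℝ := Matrix.of fun b a =>
    s' * e.symm (single a.1 a.2 1) b.1 b.2
  have hP : ∀ a b, 0 ≤ P a b := fun a b => hsL _ _ _ _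
  have hQ : ∀ a b, 0 ≤ Q a b := fun a b => hsL' _ _ _ _
  have hPQ : P * Q = (s * s') • (1 : Matrix (Fin m × Fin n) (Fin m × Fin n) ℝ) := by
    ext b c
    have h1 := linearMap_apply_eq_sum L (e.symm (single c.1 c.2 1)) b.1 b.2
    have h2 : L (e.symm (single c.1 c.2 1)) = single c.1 c.2 1 := e.apply_symm_apply _
    rw [h2] at h1
    have h3 : (single c.1 c.2 1 : Matrix (Fin m) (Fin n) ℝ) b.1 b.2 =
        (1 : Matrix (Fin m × Fin n) (Fin m × Fin n) ℝ) b c := by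
      simp only [single_apply, one_apply, Prod.ext_iff, eq_comm]
    rw [Matrix.smul_apply, ← h3, h1, mul_apply, smul_eq_mul, Finset.mul_sum]
    refine Finset.sum_congr rfl fun a _ => ?_
    simp only [P, Q, of_apply]
    ring
  have hss : s * s' = 1 := by
    have h0 : 0 ≤ s * s' := by
      let b : Fin m × Fin n := (⟨0, hm⟩, ⟨0, hn⟩)
      have h1 : (P * Q) b b = s * s' := by simp [hPQ]
      rw [← h1, mul_apply]
      exact Finset.sum_nonneg fun a _ => mul_nonneg (hP _ _) (hQ _ _)
    rcases hs with rfl | rfl <;> rcases hs' with rfl | rfl <;> linarith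
  obtain ⟨τ, hτ, hτpos, hτ0⟩ := exists_monomial_of_nonneg hP hQ (by rw [hPQ, hss, one_smul])
  refine ⟨s, fun p q => P (p, q) (τ (p, q)), τ, hs, fun p q => hτpos _, hτ, fun A p q => ?_⟩
  have hs2 : s * s = 1 := by rcases hs with rfl | rfl <;> norm_num
  have hent : ∀ a : Fin m × Fin n, L (single a.1 a.2 1) p q = s * P (p, q) a := by
    intro a
    simp only [P, of_apply]
    linear_combination (-L (single a.1 a.2 1) p q) * hs2
  rw [linearMap_apply_eq_sum, Finset.sum_eq_single (τ (p, q))]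
  · rw [hent]
  · intro a _ ha
    rw [hent, hτ0 _ _ ha, mul_zero, zero_mul]
  · simp

theorem isSSRComposition_of_image_eq {m n k : ℕ} (hk : 2 ≤ k) (hm : 2 ≤ m) (hn : 2 ≤ n)
    (L : Matrix (Fin m) (Fin n) ℝ →ₗ[ℝ] Matrix (Fin m) (Fin n) ℝ)
    (hL : L '' {A | IsSSRk k A} = {A | IsSSRk k A}) : IsSSRComposition m n L := by
  obtain ⟨s, d, τ, hs, hd, hτ, hLA⟩ :=
    exists_monomial_form (one_le_two.trans hk) (by omega) (by omega) L hL
  have hmaps : ∀ A, IsSSRk k A → IsSSRk k (L A) := fun A hA =>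
    hL.subset (Set.mem_image_of_mem L hA)
  have hrect := preservesRectangles_of_monomial hk hmaps hd hτ hLA
  let i₀ : Fin m := ⟨0, by omega⟩
  let i₁ : Fin m := ⟨1, by omega⟩
  let j₀ : Fin n := ⟨0, by omega⟩
  let j₁ : Fin n := ⟨1, by omega⟩
  have hi : i₀ ≠ i₁ := Fin.ne_of_lt Nat.zero_lt_one
  have hj : j₀ ≠ j₁ := Fin.ne_of_lt Nat.zero_lt_one
  rcases hrect i₀ i₁ j₀ j₁ hi hj with h | h
  · obtain ⟨α, β, hα, hβ, hαβ⟩ := hrect.exists_prod hτ hi hj h.1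
    exact isSSRComposition_of_product hk hm hn hmaps hs hd hα hβ fun A p q => by rw [hLA, hαβ]
  · obtain ⟨α, β, hα, hβ, hαβ⟩ :=
      hrect.swap.exists_prod (Prod.swap_injective.comp hτ) hi hj h.2.2.1
    have hαβ' : ∀ p q, τ (p, q) = (β q, α p) := fun p q => by
      rw [← Prod.swap_swap (τ (p, q)), ← Function.comp_apply (f := Prod.swap) (g := τ), hαβ,
        Prod.swap_prod_mk]
    have hmn : m = n := le_antisymm (by simpa using Fintype.card_le_of_injective α hα)
      (by simpa using Fintype.card_le_of_injective β hβ)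
    subst hmn
    have hT : IsSSRComposition m m Matrix.transpose :=
      ElemSSRMap.isSSRComposition (Or.inr (Or.inr (Or.inr (Or.inr ⟨rfl, rfl⟩))))
    have hLT : IsSSRComposition m m (L ∘ Matrix.transpose) :=
      isSSRComposition_of_product hk hm hn (fun A hA => hmaps _ hA.transpose) hs hd hα hβ
        fun A p q => by rw [Function.comp_apply, hLA, hαβ', transpose_apply]
    exact hLT.comp hT

/-- for `m = n ≥ 3`, or `m ≠ n` with `m, n ≥ 2`, a linear map
`𝓛 : ℝ^{m×n} → ℝ^{m×n}` maps the SSR matrices onto themselves iff it maps the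
SSR₂ matrices onto themselves, iff it is a composition of one or more
elementary transformations (a)–(e). -/
theorem ssr_linear_preserver (m n : ℕ)
    (hmn : (m = n ∧ 3 ≤ m) ∨ (m ≠ n ∧ 2 ≤ m ∧ 2 ≤ n))
    (𝓛 : Matrix (Fin m) (Fin n) ℝ →ₗ[ℝ] Matrix (Fin m) (Fin n) ℝ) :
    ((⇑𝓛 '' {A | IsSSR A} = {A | IsSSR A}) ↔
      (⇑𝓛 '' {A | IsSSRk 2 A} = {A | IsSSRk 2 A})) ∧
    ((⇑𝓛 '' {A | IsSSRk 2 A} = {A | IsSSRk 2 A}) ↔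
      (∃ L : List (Matrix (Fin m) (Fin n) ℝ → Matrix (Fin m) (Fin n) ℝ),
        L ≠ [] ∧ (∀ T ∈ L, ElemSSRMap m n T) ∧ ⇑𝓛 = L.foldr (· ∘ ·) id)) := by
  have hm : 2 ≤ m := by omega
  have hn : 2 ≤ n := by omega
  have key : ∀ k, 2 ≤ k →
      (𝓛 '' {A | IsSSRk k A} = {A | IsSSRk k A} ↔ IsSSRComposition m n 𝓛) := fun k hk =>
    ⟨isSSRComposition_of_image_eq hk hm hn 𝓛, fun h => h.image_eq k⟩
  exact ⟨(key _ (le_min hm hn)).trans (key 2 le_rfl).symm, key 2 le_rfl⟩
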